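/- Let U ∈ G, write ρe = E − (m₁²+m₂²)/(2ρ), p = (γ−1)ρe, v₁ = m₁/ρ, and let α > |v₁|. Then for each sign choice ±, the internal energy of the shifted state satisfies the identity ρe(U ± (1/α)F₁(U)) = (1 − p²/(2(α ± v₁)² ρ² e)) (1 ± v₁/α) ρe, where for a state W = (ρ', m₁', m₂', E') one defines ρe(W) = E' − ((m₁')²+(m₂')²)/(2ρ'). -/

import Mathlib

noncomputable section

/-- Internal energy density `ρe` of a 2D Euler conservative state `W = (ρ, m₁, m₂, E)`. -/
def internalEnergy (W : Fin 4 → ℝ) : ℝ :=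
  W 3 - ((W 1) ^ 2 + (W 2) ^ 2) / (2 * W 0)

/-- Perfect-gas pressure. -/
def eulerPressure (γ : ℝ) (U : Fin 4 → ℝ) : ℝ :=
  (γ - 1) * internalEnergy U

/-- x-directional Euler flux. -/
def eulerFlux1 (γ : ℝ) (U : Fin 4 → ℝ) : Fin 4 → ℝ :=
  ![U 1, (U 1) ^ 2 / U 0 + eulerPressure γ U, U 1 * U 2 / U 0,
    (U 3 + eulerPressure γ U) * (U 1 / U 0)]

/-- Internal energy of `U + (1 / a) • F₁(U)` for a nonzero shift parameter `a` of either sign. -/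
theorem internalEnergy_add_smul_eulerFlux1
    (γ : ℝ) (U : Fin 4 → ℝ) (hρ : U 0 ≠ 0) (he : internalEnergy U ≠ 0)
    (a : ℝ) (ha : a ≠ 0) (hav : a + U 1 / U 0 ≠ 0) :
    internalEnergy (U + (1 / a) • eulerFlux1 γ U) =
      (1 - (eulerPressure γ U) ^ 2 /
          (2 * (a + U 1 / U 0) ^ 2 * (U 0) ^ 2 * (internalEnergy U / U 0))) *
        (1 + (U 1 / U 0) / a) * internalEnergy U := by
  have hE : U 3 = internalEnergy U + ((U 1) ^ 2 + (U 2) ^ 2) / (2 * U 0) := by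
    simp [internalEnergy]
  have expand : internalEnergy (U + (1 / a) • eulerFlux1 γ U) =
      U 3 + 1 / a * ((U 3 + eulerPressure γ U) * (U 1 / U 0)) -
        ((U 1 + 1 / a * ((U 1) ^ 2 / U 0 + eulerPressure γ U)) ^ 2 +
          (U 2 + 1 / a * (U 1 * U 2 / U 0)) ^ 2) / (2 * (U 0 + 1 / a * U 1)) := by
    simp [internalEnergy, eulerFlux1]
  rw [expand, hE]
  generalize eulerPressure γ U = p
  generalize internalEnergy U = e at he
  obtain ⟨v, hv⟩ : ∃ v, U 1 = U 0 * v := ⟨U 1 / U 0, by field_simp⟩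
  clear hE expand
  have hq : U 1 / U 0 = v := by rw [hv, mul_div_cancel_left₀ _ hρ]
  rw [hq] at hav ⊢
  rw [hv]
  clear hv hq
  generalize U 0 = r at *
  generalize U 2 = m
  have hden : r + 1 / a * (r * v) = r * (a + v) / a := by field_simp
  rw [hden]
  field_simp
  ring

theorem internal_energy_of_shifted_state
    (γ : ℝ) (hγ : 1 < γ) (U : Fin 4 → ℝ)
    (hρ : 0 < U 0) (hp : 0 < eulerPressure γ U)
    (α : ℝ) (hα : |U 1 / U 0| < α) :
    internalEnergy (U + (1 / α) • eulerFlux1 γ U) =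
        (1 - (eulerPressure γ U) ^ 2 /
            (2 * (α + U 1 / U 0) ^ 2 * (U 0) ^ 2 * (internalEnergy U / U 0))) *
          (1 + (U 1 / U 0) / α) * internalEnergy U ∧
      internalEnergy (U - (1 / α) • eulerFlux1 γ U) =
        (1 - (eulerPressure γ U) ^ 2 /
            (2 * (α - U 1 / U 0) ^ 2 * (U 0) ^ 2 * (internalEnergy U / U 0))) *
          (1 - (U 1 / U 0) / α) * internalEnergy U := by
  have hα0 : 0 < α := (abs_nonneg _).trans_lt hα
  obtain ⟨hlo, hhi⟩ := abs_lt.mp hα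
  have he : internalEnergy U ≠ 0 := right_ne_zero_of_mul hp.ne'
  refine ⟨internalEnergy_add_smul_eulerFlux1 γ U hρ.ne' he α hα0.ne' (by linarith), ?_⟩
  have h := internalEnergy_add_smul_eulerFlux1 γ U hρ.ne' he (-α) (neg_ne_zero.mpr hα0.ne')
    (by linarith)
  have hsq : (-α + U 1 / U 0) ^ 2 = (α - U 1 / U 0) ^ 2 := by ring
  rwa [hsq, div_neg, div_neg, neg_smul, ← sub_eq_add_neg, ← sub_eq_add_neg] at h
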